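/- Let (W,S) be a finite Coxeter system. For every subset J ⊆ S, the sum of the Möbius numbers μ_σ(e,v) of the shard order over all v ∈ W with D_R(v) = J equals (Σ_{I ⊆ J} (−1)^{#I} · #W_I) · #{v ∈ W : D_R(v) = J}. -/

import Mathlib

open scoped Classical

namespace ShardBHZ

variable {B : Type*} {W : Type*} [Group W] {M : CoxeterMatrix B} (cs : CoxeterSystem M W)

/-- The support `S(w)` of `w`: the set of simple reflections appearing in some
(equivalently, any) reduced word for `w`. -/
def supp (w : W) : Set B := {i | ∃ l : List B, cs.IsReduced l ∧ cs.wordProd l = w ∧ i ∈ l}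

/-- The standard parabolic subgroup `W_I` generated by the simple reflections in `I`. -/
def parab (I : Set B) : Subgroup W := Subgroup.closure (cs.simple '' I)

/-- `x` has no right descent in `I`; this characterizes the minimal length coset
representatives `W^I` of `W / W_I`. -/
def IsMinRep (I : Set B) (x : W) : Prop := ∀ i ∈ I, ¬ cs.IsRightDescent x i

/-- The BHZ order: `u ≤_β v` iff the parabolic component `v_{S(u)}` equals `u`, i.e.
`v = (v * u⁻¹) * u` is the parabolic factorization of `v` with respect to `W_{S(u)}`:
`u ∈ W_{S(u)}`, `v * u⁻¹` has no right descent in `S(u)`, and lengths add. -/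
def bhzLE (u v : W) : Prop :=
  u ∈ parab cs (supp cs u) ∧ IsMinRep cs (supp cs u) (v * u⁻¹) ∧
    cs.length v = cs.length (v * u⁻¹) + cs.length u

/-- The set `N(w)` of left inversions of `w`. -/
def invSet (w : W) : Set W := {t | cs.IsLeftInversion w t}

/-- The subgroup `G(w)` generated by `w * s * w⁻¹` for `s` a right descent of `w`. -/
def descConj (w : W) : Subgroup W :=
  Subgroup.closure {x | ∃ i, cs.IsRightDescent w i ∧ x = w * cs.simple i * w⁻¹}

/-- The shard intersection order: `u ≤_σ v` iff `N(u) ⊆ N(v)` and `G(u) ⊆ G(v)`. -/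
def shardLE (u v : W) : Prop := invSet cs u ⊆ invSet cs v ∧ descConj cs u ≤ descConj cs v

section GeometricRepresentation

open Module Polynomial.Chebyshev

/-- A product of two reflections whose trace parameter is `2 cos (2π / m)` has order dividing
`m`. -/
lemma reflection_mul_reflection_pow_eq_one {V : Type*} [AddCommGroup V] [Module ℝ V]
    {x y : V} {f g : Dual ℝ V} (hf : f x = 2) (hg : g y = 2) {m : ℕ} (hm : 2 < m)
    (h : f y * g x - 2 = 2 * Real.cos (2 * Real.pi / m)) :
    (reflection hf * reflection hg) ^ m = 1 := by
  have hm0 : (0 : ℝ) < m := by positivity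
  have hm2 : (2 : ℝ) < m := by exact_mod_cast hm
  have hsin : Real.sin (2 * Real.pi / m) ≠ 0 := by
    refine (Real.sin_pos_of_pos_of_lt_pi (by positivity) ?_).ne'
    rw [div_lt_iff₀ hm0]
    nlinarith [Real.pi_pos]
  have hS (n : ℤ) := S_two_mul_real_cos (2 * Real.pi / m) n
  ext z
  rw [reflection_mul_reflection_pow_apply hf hg m z _ h.symm]
  obtain ⟨k, rfl | rfl⟩ := m.even_or_odd'
  · have e1 : (((2 * k : ℕ) : ℤ) - 2) / 2 = k - 1 := by lia
    have e2 : (((2 * k : ℕ) : ℤ) - 1) / 2 = k - 1 := by lia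
    have h0 : (S ℝ ((k : ℤ) - 1)).eval (2 * Real.cos (2 * Real.pi / (2 * k : ℕ))) = 0 := by
      refine (mul_eq_zero.1 ((hS _).trans ?_)).resolve_right hsin
      convert Real.sin_pi using 2
      have hk : (k : ℝ) ≠ 0 := by
        rintro h
        simp [h] at hm0
      push_cast
      field_simp
      ring
    rw [e1, e2, h0]
    simp
  · have e1 : (((2 * k + 1 : ℕ) : ℤ) - 2) / 2 = k - 1 := by lia
    have e2 : (((2 * k + 1 : ℕ) : ℤ) - 1) / 2 = k := by lia
    have e3 : (((2 * k + 1 : ℕ) : ℤ) - 3) / 2 = k - 1 := by lia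
    have e4 : ((2 * k + 1 : ℕ) : ℤ) / 2 = k := by lia
    have h0 : (S ℝ (k : ℤ)).eval (2 * Real.cos (2 * Real.pi / (2 * k + 1 : ℕ))) +
        (S ℝ ((k : ℤ) - 1)).eval (2 * Real.cos (2 * Real.pi / (2 * k + 1 : ℕ))) = 0 := by
      refine (mul_eq_zero.1 ?_).resolve_right hsin
      have hk : ((k : ℤ) + 1 : ℝ) * (2 * Real.pi / (2 * k + 1 : ℕ)) =
          2 * Real.pi - (((k : ℤ) - 1 : ℤ) + 1 : ℝ) * (2 * Real.pi / (2 * k + 1 : ℕ)) := by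
        push_cast at hm0 ⊢
        field_simp
        ring
      rw [add_mul, hS, hS, hk, Real.sin_two_pi_sub, neg_add_cancel]
    rw [e1, e2, e3, e4, h0]
    simp

/-- The coroot functional of a simple reflection in the geometric representation. -/
noncomputable def corootForm (M : CoxeterMatrix B) (i : B) : Dual ℝ (B →₀ ℝ) :=
  Finsupp.linearCombination ℝ fun k ↦ -2 * Real.cos (Real.pi / M i k)

lemma corootForm_single (i k : B) :
    corootForm M i (Finsupp.single k 1) = -2 * Real.cos (Real.pi / M i k) := by
  simp [corootForm]

lemma corootForm_self (i : B) : corootForm M i (Finsupp.single i 1) = 2 := by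
  simp [corootForm_single]

/-- The reflection by which a simple generator acts in the geometric representation. -/
noncomputable def geomReflection (M : CoxeterMatrix B) (i : B) : (B →₀ ℝ) ≃ₗ[ℝ] (B →₀ ℝ) :=
  reflection (corootForm_self (M := M) i)

lemma geomReflection_isLiftable : M.IsLiftable (geomReflection M) := by
  intro i j
  by_cases hij : i = j
  · subst hij
    ext1 z
    simpa [geomReflection, LinearEquiv.mul_apply] using involutive_reflection _ z
  have h1 : M i j ≠ 1 := M.off_diagonal i j hij
  rcases (show M i j = 0 ∨ M i j = 2 ∨ 2 < M i j by lia) with h | h | h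
  · simp [h]
  · have hc (a b : B) (hab : M a b = 2) : corootForm M a (Finsupp.single b 1) = 0 := by
      simp [corootForm_single, hab]
    rw [h]
    ext1 z
    simp only [geomReflection, pow_two, LinearEquiv.mul_apply, reflection_apply, map_sub, map_smul,
      hc i j h, hc j i (M.symmetric j i ▸ h), corootForm_self,
      LinearEquiv.coe_one, id]
    module
  · refine reflection_mul_reflection_pow_eq_one _ _ h ?_
    rw [corootForm_single, corootForm_single, M.symmetric j i, mul_div_assoc, Real.cos_two_mul]
    ring

/-- The geometric representation of a Coxeter group. -/
noncomputable def geomRep : W →* ((B →₀ ℝ) ≃ₗ[ℝ] (B →₀ ℝ)) :=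
  cs.lift ⟨geomReflection M, geomReflection_isLiftable⟩

lemma geomRep_simple_apply (i : B) (z : B →₀ ℝ) :
    geomRep cs (cs.simple i) z = z - corootForm M i z • Finsupp.single i 1 := by
  rw [geomRep, cs.lift_apply_simple geomReflection_isLiftable]
  rfl

/-- A simple reflection lies in `W_I` only if its index lies in `I`. -/
lemma mem_of_simple_mem_parab {I : Set B} {i : B} (h : cs.simple i ∈ parab cs I) : i ∈ I := by
  by_contra hi
  have key (g : W) (hg : g ∈ parab cs I) : ∀ z : B →₀ ℝ, geomRep cs g z i = z i := by
    induction hg using Subgroup.closure_induction with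
    | mem x hx =>
      obtain ⟨k, hk, rfl⟩ := hx
      intro z
      have : k ≠ i := fun e ↦ hi (e ▸ hk)
      simp [geomRep_simple_apply, this]
    | one => simp
    | mul x y _ _ hx hy => intro z; rw [map_mul, LinearEquiv.mul_apply, hx, hy]
    | inv x _ hx =>
      intro z
      rw [← hx, ← LinearEquiv.mul_apply, ← map_mul, mul_inv_cancel, map_one]
      rfl
  have := key _ h (Finsupp.single i 1)
  rw [geomRep_simple_apply, corootForm_self] at this
  norm_num at this

lemma simple_injective : Function.Injective cs.simple := fun i j h ↦ by
  have : cs.simple i ∈ parab cs {j} := h ▸ Subgroup.subset_closure ⟨j, rfl, rfl⟩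
  simpa using mem_of_simple_mem_parab cs this

end GeometricRepresentation

section Inversions

/-- The action of a simple reflection on `W × ℤ/2` that records inversions. -/
noncomputable def paritySwap (i : B) : Function.End (W × ZMod 2) := fun p ↦
  (cs.simple i * p.1 * cs.simple i, p.2 + if p.1 = cs.simple i then 1 else 0)

lemma paritySwap_mul_pow_apply (i j : B) (n : ℕ) (p : W × ZMod 2) :
    ((paritySwap cs i * paritySwap cs j) ^ n) p =
      ((cs.simple i * cs.simple j) ^ n * p.1 * (cs.simple j * cs.simple i) ^ n,
        p.2 + ∑ k ∈ Finset.range (2 * n),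
          if p.1 = (cs.simple j * cs.simple i) ^ k * cs.simple j then 1 else 0) := by
  induction n with
  | zero => simp; rfl
  | succ n ih =>
    set r := cs.simple j * cs.simple i with hr
    have hri : (cs.simple i * cs.simple j) = r⁻¹ := by simp [hr]
    have hrs : r * cs.simple j = cs.simple j * r⁻¹ := by simp [hr, mul_assoc]
    have hrj (k : ℕ) : r ^ k * cs.simple j = cs.simple j * (r ^ k)⁻¹ := by
      rw [← inv_pow]
      exact (SemiconjBy.pow_right (show SemiconjBy (cs.simple j) r⁻¹ r from hrs.symm) k).eq.symm
    have h1 : (r⁻¹ ^ n * p.1 * r ^ n = cs.simple j) ↔ p.1 = r ^ (2 * n) * cs.simple j := by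
      rw [← eq_mul_inv_iff_mul_eq, inv_pow, inv_mul_eq_iff_eq_mul, ← hrj, ← mul_assoc, two_mul,
        pow_add]
    have h2 : (cs.simple j * (r⁻¹ ^ n * p.1 * r ^ n) * cs.simple j = cs.simple i) ↔
        p.1 = r ^ (2 * n + 1) * cs.simple j := by
      have : cs.simple j * cs.simple i * cs.simple j = r * cs.simple j := rfl
      rw [← eq_mul_inv_iff_mul_eq, ← eq_inv_mul_iff_mul_eq, ← eq_mul_inv_iff_mul_eq, inv_pow,
        inv_mul_eq_iff_eq_mul, cs.inv_simple, ← mul_assoc (cs.simple j), this, mul_assoc r, ← hrj,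
        two_mul, pow_succ, pow_add]
      simp only [mul_assoc, ← pow_succ]
      simp only [← mul_assoc, ← pow_succ', ← pow_add]
    rw [pow_succ']
    change paritySwap cs i (paritySwap cs j
      (((paritySwap cs i * paritySwap cs j) ^ n) p)) = _
    rw [ih, hri]
    rw [show 2 * (n + 1) = 2 * n + 1 + 1 by ring, Finset.sum_range_succ, Finset.sum_range_succ]
    simp only [paritySwap, h1, h2]
    ext
    · rw [pow_succ r n, pow_succ' r⁻¹ n, ← hri, hr]
      simp only [mul_assoc]
    · simp only []
      ring

lemma paritySwap_isLiftable : M.IsLiftable (paritySwap cs) := by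
  intro i j
  funext p
  rw [paritySwap_mul_pow_apply, two_mul, Finset.sum_range_add, cs.simple_mul_simple_pow,
    cs.simple_mul_simple_pow']
  simp only [pow_add, cs.simple_mul_simple_pow', one_mul, mul_one]
  rw [CharTwo.add_self_eq_zero, add_zero]
  rfl

/-- The action of `W` on `W × ℤ/2` that records inversions. -/
noncomputable def parityRep : W →* Function.End (W × ZMod 2) :=
  cs.lift ⟨paritySwap cs, paritySwap_isLiftable cs⟩

/-- The parity of the number of times `t` occurs among the right inversions of a word for `w`. -/
noncomputable def invParity (w t : W) : ZMod 2 := (parityRep cs w (t, 0)).2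

lemma parityRep_simple (i : B) : parityRep cs (cs.simple i) = paritySwap cs i :=
  cs.lift_apply_simple (paritySwap_isLiftable cs) i

lemma parityRep_apply (w : W) (p : W × ZMod 2) :
    parityRep cs w p = (w * p.1 * w⁻¹, p.2 + invParity cs w p.1) := by
  suffices h : ∀ t ε, parityRep cs w (t, ε) = (w * t * w⁻¹, ε + invParity cs w t) from h p.1 p.2
  unfold invParity
  induction w using cs.simple_induction_left with
  | one =>
    intro t ε
    rw [map_one]
    change (t, ε) = (1 * t * 1⁻¹, ε + 0)
    simp
  | mul_simple_left w i ih =>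
    intro t ε
    rw [map_mul, parityRep_simple]
    change paritySwap cs i (parityRep cs w (t, ε)) =
      (_, ε + (paritySwap cs i (parityRep cs w (t, 0))).2)
    rw [ih, ih t 0]
    simp [paritySwap, mul_assoc, add_assoc]

lemma invParity_mul (a b t : W) :
    invParity cs (a * b) t = invParity cs b t + invParity cs a (b * t * b⁻¹) := by
  have : parityRep cs (a * b) (t, 0) = parityRep cs a (parityRep cs b (t, 0)) := by
    rw [map_mul]; rfl
  rw [invParity, this, parityRep_apply cs b, parityRep_apply cs a]
  simp

lemma invParity_simple (i : B) (t : W) :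
    invParity cs (cs.simple i) t = if t = cs.simple i then 1 else 0 := by
  rw [invParity, parityRep_simple]
  simp [paritySwap]

lemma invParity_one (t : W) : invParity cs 1 t = 0 := by
  rw [invParity, map_one]
  rfl

lemma invParity_wordProd (ω : List B) (t : W) :
    invParity cs (cs.wordProd ω) t = ((cs.rightInvSeq ω).count t : ZMod 2) := by
  induction ω with
  | nil => simp [invParity_one]
  | cons i ω ih =>
    rw [cs.wordProd_cons, invParity_mul, ih, invParity_simple, CoxeterSystem.rightInvSeq,
      List.count_cons]
    have : (cs.wordProd ω * t * (cs.wordProd ω)⁻¹ = cs.simple i) ↔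
        ((cs.wordProd ω)⁻¹ * cs.simple i * cs.wordProd ω == t) = true := by
      rw [beq_iff_eq, mul_inv_eq_iff_eq_mul, mul_assoc, inv_mul_eq_iff_eq_mul, eq_comm]
    simp only [this]
    push_cast
    rfl

lemma invParity_self {t : W} (ht : cs.IsReflection t) : invParity cs t t = 1 := by
  obtain ⟨w, i, rfl⟩ := ht
  have h := invParity_mul cs w w⁻¹ (w * cs.simple i * w⁻¹)
  rw [mul_inv_cancel, invParity_one] at h
  have e : w⁻¹ * (w * cs.simple i * w⁻¹) * w⁻¹⁻¹ = cs.simple i := by group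
  rw [e] at h
  rw [invParity_mul, invParity_mul, e, invParity_simple, if_pos rfl, cs.inv_simple,
    cs.simple_mul_simple_self, one_mul]
  linear_combination -h

/-- The strong exchange property, in terms of inversion parities. -/
lemma isRightInversion_iff_invParity (w t : W) :
    cs.IsRightInversion w t ↔ invParity cs w t = 1 := by
  have key (w : W) (h : invParity cs w t = 1) : cs.IsRightInversion w t := by
    obtain ⟨ω, hω, rfl⟩ := cs.exists_isReduced w
    refine cs.isRightInversion_of_mem_rightInvSeq hω ?_
    by_contra hmem
    rw [invParity_wordProd, List.count_eq_zero_of_not_mem hmem] at h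
    simp at h
  refine ⟨fun h ↦ ?_, key w⟩
  by_contra hw
  have h0 : invParity cs w t = 0 := by
    generalize invParity cs w t = x at hw
    revert hw
    revert x
    decide
  have h1 : invParity cs (w * t) t = 1 := by
    rw [invParity_mul, invParity_self cs h.1, mul_inv_cancel_right, h0, add_zero]
  exact (h.1.isRightInversion_mul_left_iff.1 (key _ h1)) h

/-- The cocycle property of left inversions. -/
lemma isLeftInversion_mul_iff (a b t : W) :
    cs.IsLeftInversion (a * b) t ↔
      Xor (cs.IsLeftInversion a t) (cs.IsLeftInversion b (a⁻¹ * t * a)) := by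
  simp only [← cs.isRightInversion_inv_iff, isRightInversion_iff_invParity]
  rw [mul_inv_rev, invParity_mul, inv_inv]
  generalize invParity cs a⁻¹ t = x
  generalize invParity cs b⁻¹ (a⁻¹ * t * a) = y
  revert x y
  unfold Xor
  decide

lemma isLeftInversion_simple_iff (i : B) (t : W) :
    cs.IsLeftInversion (cs.simple i) t ↔ t = cs.simple i := by
  rw [← cs.isRightInversion_inv_iff, cs.inv_simple, isRightInversion_iff_invParity,
    invParity_simple]
  simp

lemma not_isLeftInversion_one (t : W) : ¬ cs.IsLeftInversion 1 t := by
  simp [CoxeterSystem.IsLeftInversion]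

lemma isLeftInversion_of_mul {a b t : W} (h : cs.IsLeftInversion (a * b) t)
    (ha : ¬ cs.IsLeftInversion a t) : cs.IsLeftInversion b (a⁻¹ * t * a) := by
  rw [isLeftInversion_mul_iff] at h
  exact h.or.resolve_left ha

lemma isLeftInversion_inv_iff (w t : W) :
    cs.IsLeftInversion w⁻¹ t ↔ cs.IsLeftInversion w (w * t * w⁻¹) := by
  have h := isLeftInversion_mul_iff cs w⁻¹ w t
  rw [inv_mul_cancel, inv_inv] at h
  have := not_isLeftInversion_one cs t
  simp only [Xor] at h
  tauto

end Inversions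

section WeakOrder

/-- The right weak order: `u` is a prefix of a reduced word for `v`. -/
def IsPrefix (u v : W) : Prop := cs.length u + cs.length (u⁻¹ * v) = cs.length v

variable {cs}

lemma isPrefix_of_length_le {u v : W} (h : cs.length u + cs.length (u⁻¹ * v) ≤ cs.length v) :
    IsPrefix cs u v := by
  have := cs.length_mul_le u (u⁻¹ * v)
  rw [mul_inv_cancel_left] at this
  exact le_antisymm h this

lemma IsPrefix.invSet_subset {u v : W} (h : IsPrefix cs u v) : invSet cs u ⊆ invSet cs v := by
  rintro t ⟨ht, htu⟩
  refine ⟨ht, ?_⟩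
  have := cs.length_mul_le (t * u) (u⁻¹ * v)
  rw [mul_assoc, mul_inv_cancel_left] at this
  unfold IsPrefix at h
  omega

lemma isPrefix_one (v : W) : IsPrefix cs 1 v := by simp [IsPrefix]

lemma isPrefix_mul_simple {v : W} {i : B} (h : ¬ cs.IsRightDescent v i) :
    IsPrefix cs v (v * cs.simple i) := by
  rw [cs.not_isRightDescent_iff] at h
  simp [IsPrefix, h]

lemma IsPrefix.mul_simple {v w : W} (h : IsPrefix cs v w) {i : B}
    (hi : cs.IsLeftDescent (v⁻¹ * w) i) : IsPrefix cs (v * cs.simple i) w := by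
  rw [cs.isLeftDescent_iff] at hi
  apply isPrefix_of_length_le
  have := cs.length_mul_le v (cs.simple i)
  rw [cs.length_simple] at this
  unfold IsPrefix at h
  rw [mul_inv_rev, cs.inv_simple, mul_assoc]
  omega

lemma isPrefix_of_invSet_subset {u v : W} (h : invSet cs u ⊆ invSet cs v) : IsPrefix cs u v := by
  induction hn : cs.length u generalizing u with
  | zero =>
    rw [cs.length_eq_zero_iff] at hn
    exact hn ▸ isPrefix_one v
  | succ n ih =>
    obtain ⟨i, hi⟩ := cs.exists_rightDescent_of_ne_one (w := u)
      (by rintro rfl; simp at hn)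
    obtain ⟨x, rfl⟩ : ∃ x, u = x * cs.simple i := ⟨u * cs.simple i, by simp⟩
    have hxi : ¬ cs.IsRightDescent x i := by
      rw [cs.isRightDescent_iff_not_isRightDescent_mul] at hi
      simpa using hi
    have hx := isPrefix_mul_simple hxi
    have hlen := cs.not_isRightDescent_iff.1 hxi
    have hxv : IsPrefix cs x v := ih (hx.invSet_subset.trans h) (by omega)
    refine hxv.mul_simple ?_
    have hr : cs.IsReflection (x * cs.simple i * x⁻¹) := (cs.isReflection_simple i).conj x
    have h1 : cs.IsLeftInversion (x * (x⁻¹ * v)) (x * cs.simple i * x⁻¹) := by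
      rw [mul_inv_cancel_left]
      refine h ⟨hr, ?_⟩
      simp only [inv_mul_cancel_right, ← mul_assoc, CoxeterSystem.simple_mul_simple_cancel_right]
      omega
    have h2 : ¬ cs.IsLeftInversion x (x * cs.simple i * x⁻¹) := by
      rintro ⟨-, h2⟩
      rw [inv_mul_cancel_right] at h2
      omega
    have h3 := isLeftInversion_of_mul cs h1 h2
    rw [← cs.isLeftInversion_simple_iff_isLeftDescent]
    convert h3 using 1
    group

lemma isPrefix_iff_invSet_subset {u v : W} : IsPrefix cs u v ↔ invSet cs u ⊆ invSet cs v :=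
  ⟨IsPrefix.invSet_subset, isPrefix_of_invSet_subset⟩

lemma IsPrefix.trans {u v w : W} (h : IsPrefix cs u v) (h' : IsPrefix cs v w) :
    IsPrefix cs u w :=
  isPrefix_of_invSet_subset (h.invSet_subset.trans h'.invSet_subset)

lemma IsPrefix.eq_of_length_le {u v : W} (h : IsPrefix cs u v)
    (hl : cs.length v ≤ cs.length u) : u = v := by
  unfold IsPrefix at h
  have : cs.length (u⁻¹ * v) = 0 := by omega
  rw [cs.length_eq_zero_iff] at this
  exact inv_mul_eq_one.1 this

lemma IsPrefix.length_le {u v : W} (h : IsPrefix cs u v) : cs.length u ≤ cs.length v := by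
  unfold IsPrefix at h
  omega

lemma IsPrefix.isLeftDescent {u v : W} (h : IsPrefix cs u v) {i : B}
    (hi : cs.IsLeftDescent u i) : cs.IsLeftDescent v i := by
  rw [← cs.isLeftInversion_simple_iff_isLeftDescent] at hi ⊢
  exact h.invSet_subset hi

lemma IsPrefix.mul {z q a : W} (hz : IsPrefix cs z q) (ha : IsPrefix cs a (z⁻¹ * q)) :
    IsPrefix cs (z * a) q ∧ cs.length (z * a) = cs.length z + cs.length a := by
  have h1 := cs.length_mul_le z a
  have h2 := cs.length_mul_le (z * a) ((z * a)⁻¹ * q)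
  unfold IsPrefix at *
  simp only [mul_inv_rev, mul_assoc, mul_inv_cancel_left] at *
  omega

lemma isPrefix_mul_right {z a : W} (h : cs.length (z * a) = cs.length z + cs.length a) :
    IsPrefix cs z (z * a) := by
  simp [IsPrefix, h]

lemma IsPrefix.simple_mul {z q : W} (h : IsPrefix cs z q) {i : B}
    (hz : ¬ cs.IsLeftDescent z i) (hq : cs.IsLeftDescent q i) :
    IsPrefix cs (cs.simple i * z) q := by
  have h1 : cs.IsLeftInversion (z * (z⁻¹ * q)) (cs.simple i) := by
    rwa [mul_inv_cancel_left, cs.isLeftInversion_simple_iff_isLeftDescent]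
  have h2 := (isLeftInversion_of_mul cs h1
    (by rwa [cs.isLeftInversion_simple_iff_isLeftDescent])).2
  rw [cs.not_isLeftDescent_iff] at hz
  apply isPrefix_of_length_le
  unfold IsPrefix at h
  rw [mul_inv_rev, cs.inv_simple]
  have e : z⁻¹ * cs.simple i * z * (z⁻¹ * q) = z⁻¹ * cs.simple i * q := by group
  rw [e] at h2
  omega

lemma IsPrefix.exists_simple {z a : W} (h : IsPrefix cs z a) (hne : z ≠ a) :
    ∃ i, IsPrefix cs (z * cs.simple i) a ∧ cs.length (z * cs.simple i) = cs.length z + 1 ∧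
      cs.IsLeftDescent (z⁻¹ * a) i := by
  obtain ⟨i, hi⟩ := cs.exists_leftDescent_of_ne_one (w := z⁻¹ * a)
    (fun e ↦ hne (inv_mul_eq_one.1 e))
  have hp := h.mul_simple hi
  refine ⟨i, hp, ?_, hi⟩
  have h1 := cs.isLeftDescent_iff.1 hi
  have h2 := cs.length_mul_simple z i
  unfold IsPrefix at h hp
  rw [mul_inv_rev, cs.inv_simple, mul_assoc] at hp
  omega

lemma isLeftDescent_of_isPrefix_mul_simple {z q : W} {i : B} (hz : IsPrefix cs z q)
    (hl : cs.length (z * cs.simple i) = cs.length z + 1)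
    (h : IsPrefix cs (z * cs.simple i) q) : cs.IsLeftDescent (z⁻¹ * q) i := by
  unfold IsPrefix at hz h
  rw [mul_inv_rev, cs.inv_simple, mul_assoc] at h
  unfold CoxeterSystem.IsLeftDescent
  omega

end WeakOrder

section Parabolic

variable {cs} {I : Set B}

lemma simple_mem_parab {i : B} (hi : i ∈ I) : cs.simple i ∈ parab cs I :=
  Subgroup.subset_closure ⟨i, hi, rfl⟩

lemma mem_parab_of_isLeftInversion {h t : W} (hh : h ∈ parab cs I)
    (ht : cs.IsLeftInversion h t) : t ∈ parab cs I := by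
  induction hh using Subgroup.closure_induction generalizing t with
  | mem x hx =>
    obtain ⟨k, hk, rfl⟩ := hx
    rw [isLeftInversion_simple_iff] at ht
    exact ht ▸ simple_mem_parab hk
  | one => exact absurd ht (not_isLeftInversion_one cs t)
  | mul x y hx _ ihx ihy =>
    by_cases h : cs.IsLeftInversion x t
    · exact ihx h
    · have := ihy (isLeftInversion_of_mul cs ht h)
      have hx' : x ∈ parab cs I := hx
      rwa [Subgroup.mul_mem_cancel_right _ hx',
        Subgroup.mul_mem_cancel_left _ (inv_mem hx')] at this
  | inv x hx ihx =>
    have hx' : x ∈ parab cs I := hx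
    have := ihx ((isLeftInversion_inv_iff cs x t).1 ht)
    rwa [Subgroup.mul_mem_cancel_right _ (inv_mem hx'),
      Subgroup.mul_mem_cancel_left _ hx'] at this

lemma mem_of_isLeftDescent {h : W} (hh : h ∈ parab cs I) {i : B}
    (hi : cs.IsLeftDescent h i) : i ∈ I :=
  mem_of_simple_mem_parab cs (mem_parab_of_isLeftInversion hh
    ((cs.isLeftInversion_simple_iff_isLeftDescent h i).2 hi))

/-- Induction along reduced words in a standard parabolic subgroup. -/
lemma parab_induction {P : W → Prop} (one : P 1)
    (step : ∀ i ∈ I, ∀ a ∈ parab cs I, ¬ cs.IsLeftDescent a i → P a → P (cs.simple i * a))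
    {a : W} (ha : a ∈ parab cs I) : P a := by
  induction hn : cs.length a generalizing a with
  | zero =>
    rw [cs.length_eq_zero_iff] at hn
    exact hn ▸ one
  | succ n ih =>
    obtain ⟨i, hi⟩ := cs.exists_leftDescent_of_ne_one (w := a) (by rintro rfl; simp at hn)
    have hiI := mem_of_isLeftDescent ha hi
    have hmem := mul_mem (simple_mem_parab (cs := cs) hiI) ha
    have hd := cs.isLeftDescent_iff_not_isLeftDescent_mul.1 hi
    have hl := cs.isLeftDescent_iff.1 hi
    simpa using step i hiI _ hmem hd (ih hmem (by omega))

lemma isPrefix_of_forall_isLeftDescent {q : W} (hq : ∀ i ∈ I, cs.IsLeftDescent q i) {a : W}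
    (ha : a ∈ parab cs I) : IsPrefix cs a q :=
  parab_induction (P := fun a ↦ IsPrefix cs a q) (isPrefix_one q)
    (fun i hi _ _ hai hpre ↦ hpre.simple_mul hai (hq i hi)) ha

lemma length_mul_of_forall_isRightDescent {w : W} (hw : ∀ i ∈ I, cs.IsRightDescent w i) {a : W}
    (ha : a ∈ parab cs I) : cs.length (w * a) + cs.length a = cs.length w := by
  have := isPrefix_of_forall_isLeftDescent (q := w⁻¹)
    (fun i hi ↦ cs.isLeftDescent_inv_iff.2 (hw i hi)) ha
  unfold IsPrefix at this
  rw [← mul_inv_rev, cs.length_inv, cs.length_inv] at this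
  omega

variable (cs I) in
/-- `z` has no left descent in `I`; this characterizes the minimal length coset representatives
of `W_I \ W`. -/
def IsLeftMinRep (z : W) : Prop := ∀ i ∈ I, ¬ cs.IsLeftDescent z i

lemma IsLeftMinRep.of_isPrefix {y z : W} (hz : IsLeftMinRep cs I z) (h : IsPrefix cs y z) :
    IsLeftMinRep cs I y := fun i hi hy ↦ hz i hi (h.isLeftDescent hy)

lemma IsLeftMinRep.length_mul {z u : W} (hz : IsLeftMinRep cs I z) (hu : u ∈ parab cs I) :
    cs.length (u * z) = cs.length u + cs.length z := by
  obtain ⟨x, hx, hmin⟩ : ∃ x ∈ parab cs I, ∀ y ∈ parab cs I,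
      cs.length (x * z) ≤ cs.length (y * z) := by
    obtain ⟨x, hx, h⟩ := WellFounded.has_min
      (InvImage.wf (fun y ↦ cs.length (y * z)) wellFounded_lt) (parab cs I : Set W) ⟨1, one_mem _⟩
    exact ⟨x, hx, fun y hy ↦ not_lt.1 (h y hy)⟩
  have key {u : W} (hu : u ∈ parab cs I) :
      cs.length (u * (x * z)) = cs.length u + cs.length (x * z) := by
    refine parab_induction (P := fun u ↦ cs.length (u * (x * z)) = cs.length u + cs.length (x * z))
      (by simp) (fun i hi a ha hai ih ↦ ?_) hu
    have h1 : ¬ cs.IsLeftDescent (a * (x * z)) i := fun hd ↦ by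
      rw [← cs.isLeftInversion_simple_iff_isLeftDescent] at hd hai
      have := (isLeftInversion_of_mul cs hd hai).2
      rw [← mul_assoc] at this
      exact this.not_ge (hmin _ (mul_mem (mul_mem (mul_mem (inv_mem ha) (simple_mem_parab hi)) ha)
        hx))
    rw [cs.not_isLeftDescent_iff] at h1 hai
    rw [mul_assoc]
    omega
  have hx1 : x = 1 := by
    by_contra hne
    obtain ⟨i, hi⟩ := cs.exists_leftDescent_of_ne_one (inv_ne_one.2 hne)
    have hiI := mem_of_isLeftDescent (inv_mem hx) hi
    refine hz i hiI ?_
    have h1 := key (inv_mem hx)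
    have h2 := key (mul_mem (simple_mem_parab hiI) (inv_mem hx))
    have h3 := cs.isLeftDescent_iff.1 hi
    rw [inv_mul_cancel_left] at h1
    rw [mul_assoc, inv_mul_cancel_left] at h2
    unfold CoxeterSystem.IsLeftDescent
    omega
  simpa [hx1] using key hu

lemma exists_isLeftMinRep (w : W) : ∃ h ∈ parab cs I, IsLeftMinRep cs I (h * w) := by
  obtain ⟨x, hx, h⟩ := WellFounded.has_min
    (InvImage.wf (fun y ↦ cs.length (y * w)) wellFounded_lt) (parab cs I : Set W) ⟨1, one_mem _⟩
  refine ⟨x, hx, fun i hi hd ↦ h _ (mul_mem (simple_mem_parab hi) hx) ?_⟩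
  simpa [InvImage, mul_assoc, CoxeterSystem.IsLeftDescent] using hd

lemma IsLeftMinRep.eq_one_of_mul {z u : W} (hz : IsLeftMinRep cs I z) (hu : u ∈ parab cs I)
    (huz : IsLeftMinRep cs I (u * z)) : u = 1 := by
  have h1 := hz.length_mul hu
  have h2 := huz.length_mul (inv_mem hu)
  rw [inv_mul_cancel_left, cs.length_inv] at h2
  exact cs.length_eq_zero_iff.1 (by omega)

lemma IsLeftMinRep.not_mem_parab {z t : W} (hz : IsLeftMinRep cs I z)
    (ht : cs.IsLeftInversion z t) : t ∉ parab cs I := fun hmem ↦ by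
  have := hz.length_mul hmem
  have := ht.2
  omega

/-- If `z` is minimal in `W_I z` and `z s` is not, then `z s = r z` for some `r ∈ I`. -/
lemma IsLeftMinRep.exists_simple_mul_eq {z : W} (hz : IsLeftMinRep cs I z) {i : B}
    (hzi : ¬ IsLeftMinRep cs I (z * cs.simple i)) :
    ∃ j ∈ I, cs.simple j * z = z * cs.simple i ∧ cs.IsLeftDescent (z * cs.simple i) j := by
  simp only [IsLeftMinRep, not_forall, not_not] at hzi
  obtain ⟨j, hj, hd⟩ := hzi
  refine ⟨j, hj, ?_, hd⟩
  rw [← cs.isLeftInversion_simple_iff_isLeftDescent] at hd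
  have := isLeftInversion_of_mul cs hd
    (mt (cs.isLeftInversion_simple_iff_isLeftDescent z j).1 (hz j hj))
  rw [isLeftInversion_simple_iff] at this
  rw [← this]
  group

end Parabolic

section MaximalMinRep

variable {cs} {I : Set B} [Finite W]

lemma exists_forall_isLeftDescent (I : Set B) :
    ∃ a ∈ parab cs I, ∀ i ∈ I, cs.IsLeftDescent a i := by
  obtain ⟨a, ha, hmax⟩ := Set.exists_max_image (parab cs I : Set W) cs.length
    (Set.toFinite _) ⟨1, one_mem _⟩
  refine ⟨a, ha, fun i hi ↦ ?_⟩
  exact (hmax _ (mul_mem (simple_mem_parab hi) ha)).lt_of_ne (cs.length_simple_mul_ne a i)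

lemma IsLeftMinRep.exists_isPrefix_of_simple {q z : W} {r s : B} (hzq : IsPrefix cs z q)
    (hr : IsLeftMinRep cs I (z * cs.simple r)) (hs : IsLeftMinRep cs I (z * cs.simple s))
    (hrq : cs.IsLeftDescent (z⁻¹ * q) r) (hsq : cs.IsLeftDescent (z⁻¹ * q) s)
    (hz : IsLeftMinRep cs I z) :
    ∃ y, IsLeftMinRep cs I y ∧ IsPrefix cs y q ∧
      IsPrefix cs (z * cs.simple r) y ∧ IsPrefix cs (z * cs.simple s) y := by
  obtain ⟨a, ha, hdesc⟩ := exists_forall_isLeftDescent (cs := cs) {r, s}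
  have haq : IsPrefix cs a (z⁻¹ * q) := isPrefix_of_forall_isLeftDescent (I := {r, s})
    (by rintro i (rfl | rfl) <;> assumption) ha
  obtain ⟨hzaq, hlen⟩ := hzq.mul haq
  have hτ {τ : W} (h : τ ∈ parab cs {r, s}) :
      IsPrefix cs (z * τ) (z * a) ∧ cs.length (z * τ) = cs.length z + cs.length τ := by
    refine (isPrefix_mul_right hlen).mul ?_
    rw [inv_mul_cancel_left]
    exact isPrefix_of_forall_isLeftDescent hdesc h
  refine ⟨z * a, fun j hj hd ↦ ?_, hzaq, (hτ (simple_mem_parab (by simp))).1,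
    (hτ (simple_mem_parab (by simp))).1⟩
  rw [← cs.isLeftInversion_simple_iff_isLeftDescent] at hd
  have hmem := mem_parab_of_isLeftInversion ha (isLeftInversion_of_mul cs hd
    (mt (cs.isLeftInversion_simple_iff_isLeftDescent z j).1 (hz j hj)))
  have hl := (hτ hmem).2
  have he : z * (z⁻¹ * cs.simple j * z) = cs.simple j * z := by group
  rw [he, cs.not_isLeftDescent_iff.1 (hz j hj), add_right_inj] at hl
  obtain ⟨i, hi⟩ := cs.length_eq_one_iff.1 hl.symm
  rw [hi] at hmem he
  have hdj : cs.IsLeftDescent (z * cs.simple i) j := by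
    rw [he, CoxeterSystem.IsLeftDescent, cs.simple_mul_simple_cancel_left]
    have := cs.not_isLeftDescent_iff.1 (hz j hj)
    omega
  rcases mem_of_simple_mem_parab cs hmem with rfl | rfl
  · exact hr j hj hdj
  · exact hs j hj hdj

lemma exists_isPrefix_isPrefix {q z a b : W} (ha : IsLeftMinRep cs I a) (haq : IsPrefix cs a q)
    (hb : IsLeftMinRep cs I b) (hbq : IsPrefix cs b q) (hza : IsPrefix cs z a)
    (hzb : IsPrefix cs z b) :
    ∃ y, IsLeftMinRep cs I y ∧ IsPrefix cs y q ∧ IsPrefix cs a y ∧ IsPrefix cs b y := by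
  induction hn : cs.length q - cs.length z using Nat.strong_induction_on generalizing z a b with
  | _ n ih =>
    by_cases hzae : z = a
    · exact ⟨b, hb, hbq, hzae ▸ hzb, isPrefix_of_invSet_subset subset_rfl⟩
    by_cases hzbe : z = b
    · exact ⟨a, ha, haq, isPrefix_of_invSet_subset subset_rfl, hzbe ▸ hza⟩
    obtain ⟨r, hra, hrl, -⟩ := hza.exists_simple hzae
    obtain ⟨s, hsb, hsl, -⟩ := hzb.exists_simple hzbe
    have hzq := hza.trans haq
    have hrq := hra.trans haq
    have hsq := hsb.trans hbq
    obtain ⟨y, hy, hyq, hry, hsy⟩ := IsLeftMinRep.exists_isPrefix_of_simple hzq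
      (ha.of_isPrefix hra) (hb.of_isPrefix hsb)
      (isLeftDescent_of_isPrefix_mul_simple hzq hrl hrq)
      (isLeftDescent_of_isPrefix_mul_simple hzq hsl hsq) (ha.of_isPrefix hza)
    have hr := hrq.length_le
    have hs := hsq.length_le
    have hzy : IsPrefix cs z y := isPrefix_iff_invSet_subset.2
      ((isPrefix_mul_right (by rw [hrl, cs.length_simple])).trans hry).invSet_subset
    obtain ⟨y₁, h₁, h₁q, hay₁, hyy₁⟩ := ih _ (by omega) ha haq hy hyq hra hry rfl
    obtain ⟨y₂, h₂, h₂q, hby₂, hyy₂⟩ := ih _ (by omega) hb hbq hy hyq hsb hsy rfl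
    have hly : cs.length z < cs.length y := by
      have := hry.length_le
      omega
    have := hyq.length_le
    obtain ⟨y₃, h₃, h₃q, h₁₃, h₂₃⟩ := ih _ (by omega) h₁ h₁q h₂ h₂q hyy₁ hyy₂ rfl
    exact ⟨y₃, h₃, h₃q, hay₁.trans h₁₃, hby₂.trans h₂₃⟩

variable (cs I) in
/-- Every `q` has a largest prefix without left descents in `I`. -/
lemma exists_greatest_minRep (q : W) :
    ∃ m, IsLeftMinRep cs I m ∧ IsPrefix cs m q ∧
      ∀ a, IsLeftMinRep cs I a → IsPrefix cs a q → IsPrefix cs a m := by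
  obtain ⟨m, ⟨hm, hmq⟩, hmax⟩ := Set.exists_max_image
    {z | IsLeftMinRep cs I z ∧ IsPrefix cs z q} cs.length (Set.toFinite _)
    ⟨1, fun i _ ↦ cs.not_isLeftDescent_one i, isPrefix_one q⟩
  refine ⟨m, hm, hmq, fun a ha haq ↦ ?_⟩
  obtain ⟨y, hy, hyq, hmy, hay⟩ := exists_isPrefix_isPrefix hm hmq ha haq
    (isPrefix_one m) (isPrefix_one a)
  rwa [hmy.eq_of_length_le (hmax y ⟨hy, hyq⟩)]

variable (cs I) in
/-- The largest prefix of `q` without left descents in `I`. -/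
noncomputable def maxMinRep (q : W) : W := (exists_greatest_minRep cs I q).choose

lemma isLeftMinRep_maxMinRep (q : W) : IsLeftMinRep cs I (maxMinRep cs I q) :=
  (exists_greatest_minRep cs I q).choose_spec.1

lemma maxMinRep_isPrefix (q : W) : IsPrefix cs (maxMinRep cs I q) q :=
  (exists_greatest_minRep cs I q).choose_spec.2.1

lemma IsLeftMinRep.isPrefix_maxMinRep {a q : W} (ha : IsLeftMinRep cs I a)
    (haq : IsPrefix cs a q) : IsPrefix cs a (maxMinRep cs I q) :=
  (exists_greatest_minRep cs I q).choose_spec.2.2 a ha haq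

lemma IsLeftMinRep.eq_maxMinRep {z q : W} (hz : IsLeftMinRep cs I z) (hzq : IsPrefix cs z q)
    (hmax : ∀ i, cs.IsLeftDescent (z⁻¹ * q) i → ¬ IsLeftMinRep cs I (z * cs.simple i)) :
    z = maxMinRep cs I q := by
  by_contra hne
  obtain ⟨i, hi, hl, -⟩ := (hz.isPrefix_maxMinRep hzq).exists_simple hne
  exact hmax i (isLeftDescent_of_isPrefix_mul_simple hzq hl (hi.trans (maxMinRep_isPrefix q)))
    ((isLeftMinRep_maxMinRep q).of_isPrefix hi)

/-- The left descents of `(maxMinRep q)⁻¹ * q` are conjugated by `maxMinRep q` to left descents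
of `q` in `I`. -/
lemma exists_of_isLeftDescent_maxMinRep {q : W} {i : B}
    (hi : cs.IsLeftDescent ((maxMinRep cs I q)⁻¹ * q) i) :
    ∃ j ∈ I, cs.simple j * maxMinRep cs I q = maxMinRep cs I q * cs.simple i ∧
      cs.IsLeftDescent (maxMinRep cs I q * cs.simple i) j ∧ cs.IsLeftDescent q j := by
  have hq := (maxMinRep_isPrefix (cs := cs) (I := I) q).mul_simple hi
  have hl : ¬ IsLeftMinRep cs I (maxMinRep cs I q * cs.simple i) := fun h ↦ by
    have := (h.isPrefix_maxMinRep hq).length_le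
    have h1 := maxMinRep_isPrefix (cs := cs) (I := I) q
    have h2 := cs.isLeftDescent_iff.1 hi
    have h3 := cs.length_mul_simple (maxMinRep cs I q) i
    unfold IsPrefix at h1 hq
    rw [mul_inv_rev, cs.inv_simple, mul_assoc] at hq
    omega
  obtain ⟨j, hj, he, hd⟩ := (isLeftMinRep_maxMinRep q).exists_simple_mul_eq hl
  exact ⟨j, hj, he, hd, hq.isLeftDescent hd⟩

/-- Every left descent of `q` in `I` arises as in `exists_of_isLeftDescent_maxMinRep`. -/
lemma exists_isLeftDescent_maxMinRep {q : W} {j : B} (hj : j ∈ I) (hjq : cs.IsLeftDescent q j) :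
    ∃ i, cs.IsLeftDescent ((maxMinRep cs I q)⁻¹ * q) i ∧
      cs.simple j * maxMinRep cs I q = maxMinRep cs I q * cs.simple i := by
  set z := maxMinRep cs I q with hz
  set m := maxMinRep cs (I \ {j}) q with hm
  have hzm : IsPrefix cs z m := IsLeftMinRep.isPrefix_maxMinRep
    (fun i hi ↦ isLeftMinRep_maxMinRep q i hi.1) (maxMinRep_isPrefix q)
  have hjm : IsPrefix cs (cs.simple j) m := by
    refine IsLeftMinRep.isPrefix_maxMinRep (fun i hi hd ↦ hi.2 ?_) ?_
    · exact mem_of_isLeftDescent (I := {j}) (simple_mem_parab (Set.mem_singleton j)) hd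
    · exact isPrefix_of_forall_isLeftDescent (I := {j}) (by simpa using hjq)
        (simple_mem_parab (Set.mem_singleton j))
  have hdm : cs.IsLeftDescent m j := hjm.isLeftDescent (by simp [CoxeterSystem.IsLeftDescent])
  have hne : z ≠ m := fun e ↦ isLeftMinRep_maxMinRep q j hj (by rwa [← hz, e])
  obtain ⟨i, him, hl, -⟩ := hzm.exists_simple hne
  have hi := isLeftDescent_of_isPrefix_mul_simple (maxMinRep_isPrefix q) hl
    (him.trans (maxMinRep_isPrefix q))
  obtain ⟨k, hk, he, hd, -⟩ := exists_of_isLeftDescent_maxMinRep hi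
  have hkm := him.isLeftDescent hd
  obtain rfl : k = j := by
    by_contra hkj
    exact isLeftMinRep_maxMinRep (I := I \ {j}) q k ⟨hk, hkj⟩ hkm
  exact ⟨i, hi, he⟩

end MaximalMinRep

section Descents

variable [Finite W]

lemma finite_setOf_isRightDescent (w : W) : {i | cs.IsRightDescent w i}.Finite :=
  have := Finite.of_injective cs.simple (simple_injective cs)
  Set.toFinite _

/-- The right descents of `w` as a finset. -/
noncomputable def descents (w : W) : Finset B := (finite_setOf_isRightDescent cs w).toFinset

@[simp]
lemma mem_descents {w : W} {i : B} : i ∈ descents cs w ↔ cs.IsRightDescent w i := by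
  simp [descents]

lemma coe_descents (w : W) : (descents cs w : Set B) = {i | cs.IsRightDescent w i} := by
  ext
  simp

lemma descents_eq_empty_iff {w : W} : descents cs w = ∅ ↔ w = 1 := by
  refine ⟨fun h ↦ ?_, ?_⟩
  · by_contra hne
    obtain ⟨i, hi⟩ := cs.exists_rightDescent_of_ne_one hne
    rw [← mem_descents, h] at hi
    simp at hi
  · rintro rfl
    ext i
    simp [cs.not_isRightDescent_one]

lemma mem_descConj_iff {w x : W} :
    x ∈ descConj cs w ↔ w⁻¹ * x * w ∈ parab cs (descents cs w) := by
  have h : descConj cs w = (parab cs (descents cs w)).map (MulAut.conj w).toMonoidHom := by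
    rw [parab, MonoidHom.map_closure, descConj, Set.image_image, coe_descents]
    congr 1
    ext y
    simp [eq_comm]
  rw [h, Subgroup.mem_map_equiv]
  simp [MulAut.conj_symm_apply]

end Descents

section AlternatingSum

/-- The alternating sum of the orders of the standard parabolic subgroups of type `I ⊆ D`. -/
noncomputable def parabSum (D : Finset B) : ℤ :=
  ∑ I ∈ D.powerset, (-1 : ℤ) ^ I.card * Nat.card (parab cs (I : Set B))

lemma card_parab_image {I : Finset B} {z : W} {f : B → B}
    (hf : ∀ i ∈ I, cs.simple (f i) * z = z * cs.simple i) :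
    Nat.card (parab cs (I.image f : Finset B)) = Nat.card (parab cs (I : Set B)) := by
  have h : parab cs (I.image f : Finset B) = (parab cs I).map (MulAut.conj z).toMonoidHom := by
    rw [parab, parab, MonoidHom.map_closure, Set.image_image, Finset.coe_image, Set.image_image]
    congr 1
    refine Set.image_congr fun i hi ↦ ?_
    simp [← hf i hi]
  rw [h]
  exact (Nat.card_congr ((parab cs I).equivMapOfInjective _ (MulAut.conj z).injective).toEquiv).symm

lemma parabSum_congr {D D' : Finset B} {z : W}
    (h : ∀ i ∈ D, ∃ j ∈ D', cs.simple j * z = z * cs.simple i)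
    (h' : ∀ j ∈ D', ∃ i ∈ D, cs.simple j * z = z * cs.simple i) :
    parabSum cs D = parabSum cs D' := by
  choose! f hfD' hf using h
  have hinj : Set.InjOn f D := fun i hi j hj hij ↦ simple_injective cs <| by
    rw [← mul_right_inj z, ← hf i hi, ← hf j hj, hij]
  refine Finset.sum_nbij (Finset.image f) (fun I hI ↦ ?_) (fun I hI I' hI' e ↦ ?_)
    (fun I' hI' ↦ ?_) (fun I hI ↦ ?_)
  · rw [Finset.mem_powerset] at hI ⊢
    exact Finset.image_subset_iff.2 fun i hi ↦ hfD' i (hI hi)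
  · rw [Finset.mem_coe, Finset.mem_powerset] at hI hI'
    have e' := congrArg (fun A : Finset B ↦ (A : Set B)) e
    simp only [Finset.coe_image] at e'
    exact_mod_cast (hinj.image_eq_image_iff (by exact_mod_cast hI) (by exact_mod_cast hI')).1 e'
  · rw [Finset.mem_coe, Finset.mem_powerset] at hI'
    refine ⟨D.filter (f · ∈ I'),
      Finset.mem_coe.2 (Finset.mem_powerset.2 (Finset.filter_subset _ _)), ?_⟩
    ext j
    simp only [Finset.mem_image, Finset.mem_filter]
    refine ⟨?_, fun hj ↦ ?_⟩
    · rintro ⟨i, ⟨-, hi⟩, rfl⟩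
      exact hi
    · obtain ⟨i, hi, hij⟩ := h' j (hI' hj)
      obtain rfl : f i = j := simple_injective cs (mul_right_cancel ((hf i hi).trans hij.symm))
      exact ⟨i, ⟨hi, hj⟩, rfl⟩
  · rw [Finset.mem_powerset] at hI
    rw [card_parab_image cs fun i hi ↦ hf i (hI hi),
      Finset.card_image_of_injOn (hinj.mono (by exact_mod_cast hI))]

/-- Each coset of `W_I` inside `w W_J` has exactly one element with all of `I` as descents. -/
lemma card_parab_mul_card [Finite W] {I J : Set B} (hIJ : I ⊆ J) (w : W) :
    Nat.card (parab cs I) *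
      Nat.card {p : W // w⁻¹ * p ∈ parab cs J ∧ ∀ i ∈ I, cs.IsRightDescent p i} =
        Nat.card (parab cs J) := by
  have hle : parab cs I ≤ parab cs J := Subgroup.closure_mono (Set.image_mono hIJ)
  rw [← Nat.card_prod]
  refine Nat.card_eq_of_bijective
    (fun x ↦ ⟨w⁻¹ * x.2 * x.1, mul_mem x.2.2.1 (hle x.1.2)⟩) ⟨?_, ?_⟩
  · rintro ⟨⟨a, ha⟩, p, hp, hpI⟩ ⟨⟨b, hb⟩, q, hq, hqI⟩ h
    simp only [Subtype.mk.injEq, mul_assoc, mul_right_inj] at h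
    obtain rfl : q = p * (a * b⁻¹) := by
      rw [← mul_assoc, h, mul_inv_cancel_right]
    have h1 := length_mul_of_forall_isRightDescent hpI (mul_mem ha (inv_mem hb))
    have h2 := length_mul_of_forall_isRightDescent hqI (inv_mem (mul_mem ha (inv_mem hb)))
    rw [mul_inv_cancel_right, cs.length_inv] at h2
    obtain rfl : a = b := mul_inv_eq_one.1 (cs.length_eq_zero_iff.1 (by omega))
    simp
  · rintro ⟨g, hg⟩
    obtain ⟨x, hx, hmax⟩ := Set.exists_max_image (parab cs I : Set W)
      (fun x ↦ cs.length (w * g * x)) (Set.toFinite _) ⟨1, one_mem _⟩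
    refine ⟨⟨⟨x⁻¹, inv_mem hx⟩, w * g * x, ?_, fun i hi ↦ ?_⟩, ?_⟩
    · rw [mul_assoc, inv_mul_cancel_left]
      exact mul_mem hg (hle hx)
    · have := hmax _ (mul_mem hx (simple_mem_parab hi))
      rw [← mul_assoc] at this
      exact this.lt_of_ne (cs.length_mul_simple_ne _ i)
    · simp [mul_assoc]

lemma sum_coset_parabSum [Fintype W] (w : W) :
    ∑ p : W with w⁻¹ * p ∈ parab cs (descents cs w), parabSum cs (descents cs p ∩ descents cs w) =
      if w = 1 then 1 else 0 := by
  set J := descents cs w with hJ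
  have h1 (p : W) : parabSum cs (descents cs p ∩ J) = ∑ I ∈ J.powerset,
      if I ⊆ descents cs p then (-1 : ℤ) ^ I.card * Nat.card (parab cs (I : Set B)) else 0 := by
    rw [parabSum, ← Finset.sum_filter]
    congr 1
    ext I
    rw [Finset.mem_filter, Finset.mem_powerset, Finset.mem_powerset, Finset.subset_inter_iff,
      and_comm]
  have h2 : ∀ I ∈ J.powerset, (∑ p : W with w⁻¹ * p ∈ parab cs J,
      if I ⊆ descents cs p then (-1 : ℤ) ^ I.card * Nat.card (parab cs (I : Set B)) else 0) =
        (-1 : ℤ) ^ I.card * Nat.card (parab cs (J : Set B)) := fun I hI ↦ by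
    rw [Finset.mem_powerset] at hI
    have hc := card_parab_mul_card cs (Finset.coe_subset.2 hI) w
    rw [Nat.subtype_card (p := fun p ↦ w⁻¹ * p ∈ parab cs J ∧ ∀ i ∈ (I : Set B), _)
      (Finset.univ.filter fun p ↦ w⁻¹ * p ∈ parab cs J ∧ I ⊆ descents cs p)
      (fun p ↦ by simp [Finset.subset_iff])] at hc
    rw [← hc, ← Finset.sum_filter, Finset.sum_const, Finset.filter_filter, nsmul_eq_mul,
      Nat.cast_mul]
    ring
  simp_rw [h1]
  rw [Finset.sum_comm, Finset.sum_congr rfl h2, ← Finset.sum_mul,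
    Finset.sum_powerset_neg_one_pow_card]
  simp only [hJ, descents_eq_empty_iff]
  split_ifs with hw
  · rw [(descents_eq_empty_iff cs).2 hw]
    simp [parab]
  · simp

end AlternatingSum

section Fibers

variable {cs} [Finite W] {w p : W}

lemma isPrefix_of_mem_coset (hp : w⁻¹ * p ∈ parab cs (descents cs w)) : IsPrefix cs p w := by
  have h := length_mul_of_forall_isRightDescent (cs := cs) (w := w) (by simp) hp
  rwa [mul_inv_cancel_left, ← cs.length_inv (w⁻¹ * p), mul_inv_rev, inv_inv] at h

lemma mul_maxMinRep_shardLE (hp : w⁻¹ * p ∈ parab cs (descents cs w)) :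
    shardLE cs (p * maxMinRep cs (descents cs w) p⁻¹) w := by
  set z := maxMinRep cs (descents cs w) p⁻¹ with hz
  have hzp : IsPrefix cs z p⁻¹ := maxMinRep_isPrefix p⁻¹
  have hvp : IsPrefix cs (p * z) p := by
    unfold IsPrefix at hzp ⊢
    rw [← mul_inv_rev, cs.length_inv, cs.length_inv] at hzp
    rw [mul_inv_rev, inv_mul_cancel_right, cs.length_inv, add_comm, hzp]
  refine ⟨(hvp.trans (isPrefix_of_mem_coset hp)).invSet_subset, (Subgroup.closure_le _).2 ?_⟩
  rintro _ ⟨i, hi, rfl⟩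
  rw [← cs.isLeftDescent_inv_iff, mul_inv_rev] at hi
  obtain ⟨j, hj, he, -⟩ := exists_of_isLeftDescent_maxMinRep hi
  rw [← hz] at he
  have h : w⁻¹ * (p * z * cs.simple i * (p * z)⁻¹) * w =
      w⁻¹ * p * cs.simple j * (w⁻¹ * p)⁻¹ := by
    rw [mul_assoc p, ← he]
    group
  rw [SetLike.mem_coe, mem_descConj_iff, h]
  exact mul_mem (mul_mem hp (simple_mem_parab hj)) (inv_mem hp)

lemma eq_of_mul_maxMinRep_eq {p' : W} (hp : w⁻¹ * p ∈ parab cs (descents cs w))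
    (hp' : w⁻¹ * p' ∈ parab cs (descents cs w))
    (h : p * maxMinRep cs (descents cs w) p⁻¹ = p' * maxMinRep cs (descents cs w) p'⁻¹) :
    p = p' := by
  have hu : p'⁻¹ * p ∈ parab cs (descents cs w) := by
    simpa [mul_assoc] using mul_mem (inv_mem hp') hp
  refine (inv_mul_eq_one.1 ((isLeftMinRep_maxMinRep p⁻¹).eq_one_of_mul hu ?_)).symm
  rw [mul_assoc, h, inv_mul_cancel_left]
  exact isLeftMinRep_maxMinRep p'⁻¹

lemma exists_eq_mul_maxMinRep {v : W} (hv : shardLE cs v w) :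
    ∃ p, w⁻¹ * p ∈ parab cs (descents cs w) ∧ p * maxMinRep cs (descents cs w) p⁻¹ = v := by
  obtain ⟨h, hh, hz⟩ := exists_isLeftMinRep (cs := cs) (I := descents cs w) (w⁻¹ * v)
  obtain ⟨z, hzdef⟩ : ∃ z, z = h * (w⁻¹ * v) := ⟨_, rfl⟩
  rw [← hzdef] at hz
  obtain ⟨p, rfl⟩ : ∃ p, w = p * h := ⟨w * h⁻¹, by simp⟩
  have hv' : v = p * z := by simp [hzdef, mul_assoc]
  have hpz : z⁻¹ * p⁻¹ = v⁻¹ := by rw [hv', mul_inv_rev]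
  have hzp : IsPrefix cs z p⁻¹ := by
    refine isPrefix_of_invSet_subset fun t ht ↦ ?_
    by_contra htp
    have h1 : p * t * p⁻¹ ∈ invSet cs v := by
      have h2 : cs.IsLeftInversion v⁻¹ (z⁻¹ * t * z) := by
        by_contra h3
        have h4 := isLeftInversion_mul_iff cs z v⁻¹ t
        rw [← hpz, mul_inv_cancel_left] at h4
        rw [← hpz] at h3
        exact htp (h4.2 (Or.inl ⟨ht, h3⟩))
      have h3 : v * (z⁻¹ * t * z) * v⁻¹ = p * t * p⁻¹ := by
        rw [hv']
        group
      rw [isLeftInversion_inv_iff, h3] at h2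
      exact h2
    refine hz.not_mem_parab ht ?_
    have h2 := isLeftInversion_of_mul cs (hv.1 h1)
      (fun h3 ↦ htp ((isLeftInversion_inv_iff cs p t).2 h3))
    have h3 : p⁻¹ * (p * t * p⁻¹) * p = t := by group
    rw [h3] at h2
    exact mem_parab_of_isLeftInversion hh h2
  have hmax := hz.eq_maxMinRep hzp fun i hi hzi ↦ by
    rw [hpz, cs.isLeftDescent_inv_iff] at hi
    have h1 := hv.2 (Subgroup.subset_closure ⟨i, hi, rfl⟩)
    rw [mem_descConj_iff] at h1
    have h2 : z * cs.simple i * z⁻¹ ∈ parab cs (descents cs (p * h)) := by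
      convert mul_mem (mul_mem hh h1) (inv_mem hh) using 1
      rw [hv']
      group
    have h3 := hz.eq_one_of_mul h2 (by rwa [inv_mul_cancel_right])
    rw [mul_inv_eq_one, mul_eq_left] at h3
    simpa [h3] using cs.length_simple i
  refine ⟨p, ?_, by rw [← hmax, ← hv']⟩
  rw [mul_inv_rev, inv_mul_cancel_right]
  exact inv_mem hh

lemma parabSum_descents_mul_maxMinRep (J : Finset B) (p : W) :
    parabSum cs (descents cs (p * maxMinRep cs J p⁻¹)) = parabSum cs (descents cs p ∩ J) := by
  refine parabSum_congr cs (z := maxMinRep cs J p⁻¹) (fun i hi ↦ ?_) (fun j hj ↦ ?_)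
  · rw [mem_descents, ← cs.isLeftDescent_inv_iff, mul_inv_rev] at hi
    obtain ⟨j, hj, he, -, hd⟩ := exists_of_isLeftDescent_maxMinRep hi
    exact ⟨j, by simpa using ⟨cs.isLeftDescent_inv_iff.1 hd, hj⟩, he⟩
  · rw [Finset.mem_inter, mem_descents, ← cs.isLeftDescent_inv_iff] at hj
    obtain ⟨i, hi, he⟩ := exists_isLeftDescent_maxMinRep (I := (J : Set B)) hj.2 hj.1
    refine ⟨i, ?_, he⟩
    rwa [mem_descents, ← cs.isLeftDescent_inv_iff, mul_inv_rev]

variable (cs) in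
lemma sum_shardLE_parabSum [Fintype W] (w : W) :
    ∑ v : W with shardLE cs v w, parabSum cs (descents cs v) = if w = 1 then 1 else 0 := by
  rw [← sum_coset_parabSum cs w]
  symm
  refine Finset.sum_nbij (fun p ↦ p * maxMinRep cs (descents cs w) p⁻¹) (fun p hp ↦ ?_)
    (fun p hp p' hp' h ↦ ?_) (fun v hv ↦ ?_) (fun p _ ↦ ?_)
  · rw [Finset.mem_filter_univ] at hp ⊢
    exact mul_maxMinRep_shardLE hp
  · rw [Finset.mem_coe, Finset.mem_filter_univ] at hp hp'
    exact eq_of_mul_maxMinRep_eq hp hp' h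
  · rw [Finset.mem_coe, Finset.mem_filter_univ] at hv
    simpa using exists_eq_mul_maxMinRep hv
  · exact (parabSum_descents_mul_maxMinRep _ p).symm

end Fibers

lemma one_shardLE (v : W) : shardLE cs 1 v := by
  refine ⟨(isPrefix_one v).invSet_subset, (Subgroup.closure_le _).2 ?_⟩
  rintro _ ⟨i, hi, rfl⟩
  exact absurd hi (cs.not_isRightDescent_one i)

lemma shardLE_refl (v : W) : shardLE cs v v := ⟨subset_rfl, le_rfl⟩

/-- The Möbius function of the shard order from the identity. -/
lemma mobius_one_eq_parabSum [Fintype W] {μσ : W → W → ℤ}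
    (hσ1 : ∀ u v : W, shardLE cs u v →
      (∑ w : W, if shardLE cs u w ∧ shardLE cs w v then μσ u w else 0) =
        if u = v then 1 else 0) (v : W) :
    μσ 1 v = parabSum cs (descents cs v) := by
  induction hn : cs.length v using Nat.strong_induction_on generalizing v with
  | _ n ih =>
    have h := hσ1 1 v (one_shardLE cs v)
    simp only [one_shardLE, true_and, eq_comm (a := (1 : W))] at h
    rw [← Finset.sum_filter, ← sum_shardLE_parabSum cs v] at h
    have hv : v ∈ Finset.univ.filter (shardLE cs · v) := by simpa using shardLE_refl cs v
    rw [← Finset.add_sum_erase _ _ hv, ← Finset.add_sum_erase _ _ hv] at h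
    refine add_right_cancel (h.trans (congrArg _ (Finset.sum_congr rfl fun u hu ↦ ?_)).symm)
    rw [Finset.mem_erase, Finset.mem_filter_univ] at hu
    refine ih _ ?_ u rfl
    rw [← hn]
    exact not_le.1 fun hl ↦ hu.1 ((isPrefix_of_invSet_subset hu.2.1).eq_of_length_le hl)

/-- For every `J ⊆ S`:
`Σ_{v, D_R(v) = J} μ_σ(e,v) = (Σ_{I ⊆ J} (−1)^{#I} #W_I) · #{v : D_R(v) = J}`.
Here `μσ` is the Möbius function of the poset `(W, ≤_σ)`, characterized by its
defining recurrence. -/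
theorem shard_mobius_sum [Finite W] [Fintype W] [DecidableEq B] (μσ : W → W → ℤ)
    (hσ0 : ∀ u v : W, ¬ shardLE cs u v → μσ u v = 0)
    (hσ1 : ∀ u v : W, shardLE cs u v →
      (∑ w : W, if shardLE cs u w ∧ shardLE cs w v then μσ u w else 0) =
        if u = v then 1 else 0)
    (J : Finset B) :
    (∑ v : W, if {i : B | cs.IsRightDescent v i} = (J : Set B) then μσ 1 v else 0) =
      (∑ I ∈ J.powerset, (-1 : ℤ) ^ I.card * Nat.card (parab cs (I : Set B))) *
        Nat.card {v : W // {i : B | cs.IsRightDescent v i} = (J : Set B)} := by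
  have hJ (v : W) : {i : B | cs.IsRightDescent v i} = (J : Set B) ↔ descents cs v = J := by
    rw [← coe_descents, Finset.coe_inj]
  simp only [hJ]
  rw [← Finset.sum_filter, Finset.sum_congr rfl (g := fun _ ↦ parabSum cs J) fun v hv ↦ by
      rw [mobius_one_eq_parabSum cs hσ1, (Finset.mem_filter_univ v).1 hv],
    Finset.sum_const, Nat.subtype_card _ (fun v ↦ Finset.mem_filter_univ v), nsmul_eq_mul, mul_comm,
    parabSum]

end ShardBHZ
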